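/- Let C be a rank-metric code in F_q^{n×m} with n ≤ m. Then C is an optimal anticode if and only if maxrk(C) + maxrk(C^⊥) = n. -/

import Mathlib

open Matrix

/-- The maximum rank of a rank-metric code (an `𝔽`-linear subspace of `n × m` matrices). -/
noncomputable def maxrk {𝔽 : Type*} [Field 𝔽] {n m : ℕ}
    (C : Submodule 𝔽 (Matrix (Fin n) (Fin m) 𝔽)) : ℕ :=
  sSup (Matrix.rank '' (C : Set (Matrix (Fin n) (Fin m) 𝔽)))

/-- The dual code with respect to the trace bilinear form `⟨M, N⟩ = Tr(M Nᵗ)`. -/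
def dualCode {𝔽 : Type*} [Field 𝔽] {n m : ℕ}
    (C : Submodule 𝔽 (Matrix (Fin n) (Fin m) 𝔽)) :
    Submodule 𝔽 (Matrix (Fin n) (Fin m) 𝔽) where
  carrier := {M | ∀ N ∈ C, Matrix.trace (M * Nᵀ) = 0}
  add_mem' := by
    intro a b ha hb N hN
    show Matrix.trace ((a + b) * Nᵀ) = 0
    rw [Matrix.add_mul, Matrix.trace_add, ha N hN, hb N hN, add_zero]
  zero_mem' := by
    intro N hN
    simp
  smul_mem' := by
    intro c a ha N hN
    show Matrix.trace ((c • a) * Nᵀ) = 0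
    rw [Matrix.smul_mul, Matrix.trace_smul, ha N hN, smul_zero]

/-- `C` is an optimal anticode if `dim C = m * maxrk C`. -/
def isOptAnticode {𝔽 : Type*} [Field 𝔽] {n m : ℕ}
    (C : Submodule 𝔽 (Matrix (Fin n) (Fin m) 𝔽)) : Prop :=
  Module.finrank 𝔽 C = m * maxrk C

/-- `C` is a quasi optimal anticode if `m ∤ dim C` and `maxrk C = ⌈dim C / m⌉`. -/
def isQOAC {𝔽 : Type*} [Field 𝔽] {n m : ℕ}
    (C : Submodule 𝔽 (Matrix (Fin n) (Fin m) 𝔽)) : Prop :=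
  ¬ (m ∣ Module.finrank 𝔽 C) ∧
    (maxrk C : ℤ) = ⌈(Module.finrank 𝔽 C : ℚ) / (m : ℚ)⌉

/-- `C` is a dually quasi optimal anticode if both `C` and `C^⊥` are qOACs. -/
def isDuallyQOAC {𝔽 : Type*} [Field 𝔽] {n m : ℕ}
    (C : Submodule 𝔽 (Matrix (Fin n) (Fin m) 𝔽)) : Prop :=
  isQOAC C ∧ isQOAC (dualCode C)

/-- The code of matrices vanishing at all positions `(i, j)` with `¬ P i j`. -/
def zeroOutside {𝔽 : Type*} [Field 𝔽] {n m : ℕ} (P : Fin n → Fin m → Prop) :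
    Submodule 𝔽 (Matrix (Fin n) (Fin m) 𝔽) where
  carrier := {M | ∀ i j, ¬ P i j → M i j = 0}
  add_mem' := by
    intro a b ha hb i j h
    simp [Matrix.add_apply, ha i j h, hb i j h]
  zero_mem' := by
    intro i j h
    simp
  smul_mem' := by
    intro c a ha i j h
    simp [Matrix.smul_apply, ha i j h]

/-- `Mat(V)`: the matrices all of whose columns lie in `V ⊆ 𝔽^n`. -/
def matCol {𝔽 : Type*} [Field 𝔽] {n m : ℕ} (V : Submodule 𝔽 (Fin n → 𝔽)) :
    Submodule 𝔽 (Matrix (Fin n) (Fin m) 𝔽) where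
  carrier := {M | ∀ j, (fun i => M i j) ∈ V}
  add_mem' := by
    intro a b ha hb j
    exact V.add_mem (ha j) (hb j)
  zero_mem' := by
    intro j
    exact V.zero_mem
  smul_mem' := by
    intro c a ha j
    exact V.smul_mem c (ha j)

/-- `Mat(U)ᵗ`: the matrices all of whose rows lie in `U ⊆ 𝔽^m`. -/
def matRow {𝔽 : Type*} [Field 𝔽] {n m : ℕ} (U : Submodule 𝔽 (Fin m → 𝔽)) :
    Submodule 𝔽 (Matrix (Fin n) (Fin m) 𝔽) where
  carrier := {M | ∀ i, M i ∈ U}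
  add_mem' := by
    intro a b ha hb i
    exact U.add_mem (ha i) (hb i)
  zero_mem' := by
    intro i
    exact U.zero_mem
  smul_mem' := by
    intro c a ha i
    exact U.smul_mem c (ha i)

/-- `⟨e_1, …, e_s⟩ ⊆ 𝔽^ℓ`: the span of the first `s` canonical basis vectors. -/
def spanFirst (𝔽 : Type*) [Field 𝔽] (ℓ s : ℕ) : Submodule 𝔽 (Fin ℓ → 𝔽) :=
  Submodule.span 𝔽 ((fun i : Fin ℓ => Pi.single i (1 : 𝔽)) '' {i : Fin ℓ | (i : ℕ) < s})

/-- Orthogonal complement with respect to the standard dot product on `𝔽^ℓ`. -/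
def perp {𝔽 : Type*} [Field 𝔽] {ℓ : ℕ} (W : Submodule 𝔽 (Fin ℓ → 𝔽)) :
    Submodule 𝔽 (Fin ℓ → 𝔽) where
  carrier := {v | ∀ w ∈ W, ∑ i, v i * w i = 0}
  add_mem' := by
    intro a b ha hb w hw
    simp [add_mul, Finset.sum_add_distrib, ha w hw, hb w hw]
  zero_mem' := by
    intro w hw
    simp
  smul_mem' := by
    intro c a ha w hw
    simp [mul_assoc, ← Finset.mul_sum, ha w hw]

/-- Equivalence of rank-metric codes: `C = {N A M : A ∈ D}` for invertible `N, M`, or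
(when `n = m`) `C = {N Aᵗ M : A ∈ D}` for invertible `N, M`. -/
def equivCode {𝔽 : Type*} [Field 𝔽] {n m : ℕ}
    (C D : Submodule 𝔽 (Matrix (Fin n) (Fin m) 𝔽)) : Prop :=
  (∃ (N : Matrix (Fin n) (Fin n) 𝔽) (M : Matrix (Fin m) (Fin m) 𝔽),
      IsUnit N ∧ IsUnit M ∧
      (C : Set (Matrix (Fin n) (Fin m) 𝔽)) = (fun A : Matrix (Fin n) (Fin m) 𝔽 => N * A * M) '' (D : Set (Matrix (Fin n) (Fin m) 𝔽))) ∨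
  (∃ (h : n = m) (N : Matrix (Fin n) (Fin n) 𝔽) (M : Matrix (Fin m) (Fin m) 𝔽),
      IsUnit N ∧ IsUnit M ∧
      (C : Set (Matrix (Fin n) (Fin m) 𝔽)) =
        (fun A : Matrix (Fin n) (Fin m) 𝔽 =>
          N * (Matrix.reindex (finCongr h.symm) (finCongr h) Aᵀ) * M) ''
          (D : Set (Matrix (Fin n) (Fin m) 𝔽)))

/-- The Gaussian `q`-binomial coefficient, as a rational number. -/
def gaussBinom (q a r : ℕ) : ℚ :=
  (∏ i ∈ Finset.range r, ((q : ℚ) ^ a - (q : ℚ) ^ i)) /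
    (∏ i ∈ Finset.range r, ((q : ℚ) ^ r - (q : ℚ) ^ i))

/-- `φ_q(a, b, r)`: the number of rank-`r` matrices in `𝔽_q^{a×b}`. -/
def phiq (q a b r : ℕ) : ℚ :=
  gaussBinom q a r * ∏ i ∈ Finset.range r, ((q : ℚ) ^ b - (q : ℚ) ^ i)

open Module

/-- The `F`-linear map `v ↦ ∑ j, a j * (ι v) ^ (q ^ j)` attached to a linearized polynomial with
coefficients `a` over an extension `K` of the finite field `F` with `q` elements. -/
noncomputable def linearizedEval (F : Type*) {K V : Type*} [Field F] [Fintype F] [Field K]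
    [Algebra F K] [AddCommGroup V] [Module F V] (ι : V →ₗ[F] K) (k : ℕ) :
    (Fin k → K) →ₗ[F] V →ₗ[F] K :=
  LinearMap.mk₂ F (fun a v => ∑ j, a j * (FiniteField.frobeniusAlgHom F K ^ (j : ℕ)) (ι v))
    (fun a b v => by simp [add_mul, Finset.sum_add_distrib])
    (fun c a v => by simp [Finset.smul_sum])
    (fun a v w => by simp only [map_add, mul_add, Finset.sum_add_distrib])
    (fun c a v => by simp only [map_smul, mul_smul_comm, Finset.smul_sum])

section Linearized

variable {F K V : Type*} [Field F] [Fintype F] [Field K] [Algebra F K] [AddCommGroup V]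
  [Module F V]

theorem linearizedEval_apply (ι : V →ₗ[F] K) (k : ℕ) (a : Fin k → K) (v : V) :
    linearizedEval F ι k a v = ∑ j, a j * ι v ^ (Fintype.card F ^ (j : ℕ)) := by
  simp [linearizedEval, AlgHom.coe_pow, FiniteField.coe_frobeniusAlgHom, pow_iterate]

theorem finrank_ker_linearizedEval_lt [FiniteDimensional F V] {ι : V →ₗ[F] K}
    (hι : Function.Injective ι) {k : ℕ} {a : Fin k → K} (ha : a ≠ 0) :
    finrank F (LinearMap.ker (linearizedEval F ι k a)) < k := by
  classical
  obtain ⟨i, hi⟩ := Function.ne_iff.mp ha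
  have hq : 1 < Fintype.card F := Fintype.one_lt_card
  let p : Polynomial K := ∑ j, Polynomial.C (a j) * Polynomial.X ^ (Fintype.card F ^ (j : ℕ))
  have hp : p ≠ 0 := by
    intro h
    apply hi
    have := congrArg (fun r => Polynomial.coeff r (Fintype.card F ^ (i : ℕ))) h
    simpa [p, Polynomial.finsetSum_coeff, Polynomial.coeff_X_pow, Nat.pow_right_inj hq,
      Fin.val_inj] using this
  have hdeg : p.natDegree ≤ Fintype.card F ^ (k - 1) := by
    refine Polynomial.natDegree_sum_le_of_forall_le _ _ fun j _ => ?_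
    refine (Polynomial.natDegree_C_mul_X_pow_le _ _).trans ?_
    exact Nat.pow_le_pow_right hq.le (by omega)
  have : Finite V := Module.finite_of_finite F
  have : Fintype (LinearMap.ker (linearizedEval F ι k a)) := Fintype.ofFinite _
  have hcard : Fintype.card (LinearMap.ker (linearizedEval F ι k a)) ≤ p.natDegree := by
    have hZ := Polynomial.card_le_degree_of_subset_roots (p := p)
      (Z := Finset.univ.image fun v : LinearMap.ker (linearizedEval F ι k a) => ι v) (by
        intro x hx
        obtain ⟨v, -, rfl⟩ := Finset.mem_image.mp hx
        have hv := v.2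
        rw [LinearMap.mem_ker, linearizedEval_apply] at hv
        simpa [hp, p, Polynomial.eval_finsetSum] using hv)
    have hinj : Function.Injective
        fun v : LinearMap.ker (linearizedEval F ι k a) => ι v := hι.comp Subtype.val_injective
    rwa [Finset.card_image_of_injective _ hinj, Finset.card_univ] at hZ
  rw [Module.card_eq_pow_finrank (K := F)] at hcard
  have := (Nat.pow_le_pow_iff_right hq).mp (hcard.trans hdeg)
  have := i.pos
  omega

theorem exists_ker_linearizedEval_eq [FiniteDimensional F V] {ι : V →ₗ[F] K}
    (hι : Function.Injective ι) {k : ℕ} (W : Submodule F V) (hW : finrank F W < k) :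
    ∃ a : Fin k → K, LinearMap.ker (linearizedEval F ι k a) = W := by
  let b := Module.finBasis F W
  let A : Matrix (Fin (finrank F W)) (Fin (finrank F W + 1)) K :=
    Matrix.of fun i j => ι (b i) ^ (Fintype.card F ^ (j : ℕ))
  obtain ⟨c, hc, hc0⟩ := (Submodule.ne_bot_iff _).mp
    (LinearMap.ker_ne_bot_of_finrank_lt (f := A.mulVecLin) (by simp))
  have hker : LinearMap.ker (linearizedEval F ι _ c) = W := by
    symm
    apply Submodule.eq_of_le_of_finrank_le
    · have : (linearizedEval F ι _ c) ∘ₗ W.subtype = 0 := b.ext fun i => by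
        have := congrFun hc i
        simpa [A, Matrix.mulVec, dotProduct, linearizedEval_apply, mul_comm] using this
      intro w hw
      exact LinearMap.congr_fun this ⟨w, hw⟩
    · exact Nat.lt_succ_iff.mp (finrank_ker_linearizedEval_lt hι hc0)
  refine ⟨Function.extend (Fin.castLE hW) c 0, ?_⟩
  refine Eq.trans ?_ hker
  congr 1
  ext v
  rw [linearizedEval_apply, linearizedEval_apply]
  symm
  apply Fintype.sum_of_injective (Fin.castLE hW) (Fin.castLE_injective hW)
  · intro j hj
    rw [Function.extend_apply' _ _ _ (by simpa only [Set.mem_range] using hj)]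
    simp
  · intro j
    rw [(Fin.castLE_injective hW).extend_apply]
    simp

end Linearized

section LinearAlgebra

variable {F V V' : Type*} [Field F] [AddCommGroup V] [Module F V] [AddCommGroup V'] [Module F V']

theorem LinearMap.exists_linearEquiv_comp_eq_of_ker_eq [FiniteDimensional F V]
    {U : Type*} [AddCommGroup U] [Module F U] [FiniteDimensional F U]
    [FiniteDimensional F V'] (hd : finrank F V = finrank F V')
    (f : U →ₗ[F] V) (g : U →ₗ[F] V') (h : LinearMap.ker f = LinearMap.ker g) :
    ∃ e : V ≃ₗ[F] V', (e : V →ₗ[F] V') ∘ₗ f = g := by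
  let e₀ : V' ≃ₗ[F] V := LinearEquiv.ofFinrankEq _ _ hd.symm
  have h' : LinearMap.ker f = LinearMap.ker ((e₀ : V' →ₗ[F] V) ∘ₗ g) := by
    rw [h, LinearEquiv.ker_comp]
  obtain ⟨e, he⟩ := Submodule.exists_linearEquiv_restrict_eq
    (f.quotKerEquivRange.symm ≪≫ₗ Submodule.quotEquivOfEq _ _ h' ≪≫ₗ
      ((e₀ : V' →ₗ[F] V) ∘ₗ g).quotKerEquivRange)
  refine ⟨e ≪≫ₗ e₀.symm, LinearMap.ext fun u => ?_⟩
  have h1 := he (f.quotKerEquivRange (Submodule.Quotient.mk u))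
  simp only [LinearEquiv.trans_apply, LinearEquiv.symm_apply_apply,
    Submodule.quotEquivOfEq_mk, LinearMap.quotKerEquivRange_apply_mk] at h1
  simp [← h1]

theorem Submodule.exists_ge_finrank_eq [FiniteDimensional F V] (W : Submodule F V) {k : ℕ}
    (hW : finrank F W ≤ k) (hk : k ≤ finrank F V) :
    ∃ R : Submodule F V, W ≤ R ∧ finrank F R = k := by
  induction k, hW using Nat.le_induction with
  | base => exact ⟨W, le_rfl, rfl⟩
  | succ k _ ih =>
    obtain ⟨R, hWR, hR⟩ := ih (by omega)
    have hne : R ≠ ⊤ := by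
      rintro rfl
      rw [finrank_top] at hR
      omega
    obtain ⟨v, hv⟩ := SetLike.exists_of_lt (lt_top_iff_ne_top.mpr hne)
    refine ⟨R ⊔ F ∙ v, hWR.trans le_sup_left, ?_⟩
    rw [Submodule.finrank_sup_span_singleton hv.2, hR]

end LinearAlgebra

section RankMetric

variable {F : Type*} [Field F] {n m : ℕ}

/-- The trace form `⟨M, N⟩ = Tr(M Nᵗ)` as a bilinear form. -/
def matrixTraceForm (F : Type*) [Field F] (n m : ℕ) :
    LinearMap.BilinForm F (Matrix (Fin n) (Fin m) F) :=
  LinearMap.mk₂ F (fun M N => (M * Nᵀ).trace)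
    (fun A B N => by simp [Matrix.add_mul]) (fun c A N => by simp)
    (fun M A B => by simp [Matrix.mul_add]) (fun c M A => by simp)

theorem matrixTraceForm_apply (M N : Matrix (Fin n) (Fin m) F) :
    matrixTraceForm F n m M N = (M * Nᵀ).trace := rfl

theorem matrixTraceForm_isSymm : (matrixTraceForm F n m).IsSymm where
  eq M N := by
    rw [matrixTraceForm_apply, matrixTraceForm_apply, ← Matrix.trace_transpose,
      Matrix.transpose_mul, Matrix.transpose_transpose]

theorem matrixTraceForm_nondegenerate : (matrixTraceForm F n m).Nondegenerate := by
  have hrefl : (matrixTraceForm F n m).IsRefl := matrixTraceForm_isSymm.isRefl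
  rw [LinearMap.BilinForm.Nondegenerate, LinearMap.IsRefl.nondegenerate_iff_separatingRight hrefl]
  intro N hN
  apply Matrix.transpose_injective
  rw [Matrix.transpose_zero, Matrix.ext_iff_trace_mul_left]
  intro G
  simpa [matrixTraceForm_apply] using hN G

theorem dualCode_eq_orthogonal (C : Submodule F (Matrix (Fin n) (Fin m) F)) :
    dualCode C = (matrixTraceForm F n m).orthogonal C := by
  ext M
  exact forall₂_congr fun N _ => by
    rw [matrixTraceForm_isSymm.eq N M, matrixTraceForm_apply]

theorem finrank_add_finrank_dualCode (C : Submodule F (Matrix (Fin n) (Fin m) F)) :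
    finrank F C + finrank F (dualCode C) = n * m := by
  have h := LinearMap.BilinForm.finrank_orthogonal matrixTraceForm_nondegenerate C
  have h' := Submodule.finrank_le C
  rw [← dualCode_eq_orthogonal] at h
  simp only [Module.finrank_matrix, Fintype.card_fin, finrank_self, mul_one] at h h'
  omega

theorem rank_add_finrank_ker_vecMulLinear (M : Matrix (Fin n) (Fin m) F) :
    M.rank + finrank F (LinearMap.ker M.vecMulLinear) = n := by
  have h := M.vecMulLinear.finrank_range_add_finrank_ker
  rw [← Matrix.rank_transpose, Matrix.rank, ← Matrix.vecMulLinear_transpose,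
    Matrix.transpose_transpose, h]
  simp

theorem rank_le_maxrk {C : Submodule F (Matrix (Fin n) (Fin m) F)}
    {M : Matrix (Fin n) (Fin m) F} (hM : M ∈ C) : M.rank ≤ maxrk C := by
  refine le_csSup ⟨n, ?_⟩ ⟨M, hM, rfl⟩
  rintro _ ⟨N, -, rfl⟩
  exact N.rank_le_height

theorem maxrk_le {C : Submodule F (Matrix (Fin n) (Fin m) F)} {k : ℕ}
    (h : ∀ M ∈ C, M.rank ≤ k) : maxrk C ≤ k := by
  refine csSup_le ⟨_, 0, C.zero_mem, rfl⟩ ?_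
  rintro _ ⟨M, hM, rfl⟩
  exact h M hM

theorem vecMulLinear_transpose_toMatrix' (f : (Fin n → F) →ₗ[F] (Fin m → F)) :
    (LinearMap.toMatrix' f)ᵀ.vecMulLinear = f := by
  rw [Matrix.vecMulLinear_transpose, ← Matrix.toLin'_apply', Matrix.toLin'_toMatrix']

/-- Every matrix whose left kernel has dimension less than `k` lies in a code of dimension `k * m`
all of whose nonzero elements have left kernel of dimension less than `k` (an MRD code). -/
theorem exists_mrd_code_of_finrank_ker_lt [Fintype F] (hm : 0 < m) (hnm : n ≤ m) {k : ℕ}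
    (hk : k ≤ n) (M : Matrix (Fin n) (Fin m) F)
    (hM : finrank F (LinearMap.ker M.vecMulLinear) < k) :
    ∃ D : Submodule F (Matrix (Fin n) (Fin m) F), M ∈ D ∧ finrank F D = k * m ∧
      ∀ N ∈ D, N ≠ 0 → finrank F (LinearMap.ker N.vecMulLinear) < k := by
  obtain ⟨p, hp⟩ := CharP.exists F
  have : Fact p.Prime := ⟨CharP.char_is_prime F p⟩
  have : NeZero m := ⟨hm.ne'⟩
  let K := FiniteField.Extension F p m
  have hK : finrank F K = m := FiniteField.finrank_extension F p m
  obtain ⟨ι, hι⟩ : ∃ ι : (Fin n → F) →ₗ[F] K, Function.Injective ι :=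
    finrank_le_iff_exists_linearMap.mp (by simpa [hK] using hnm)
  obtain ⟨a, ha⟩ := exists_ker_linearizedEval_eq hι _ hM
  obtain ⟨e, he⟩ := LinearMap.exists_linearEquiv_comp_eq_of_ker_eq (by simp [hK])
    (linearizedEval F ι k a) M.vecMulLinear ha
  let Ψ : (Fin k → K) →ₗ[F] Matrix (Fin n) (Fin m) F :=
    { toFun := fun c => (LinearMap.toMatrix' ((e : K →ₗ[F] _) ∘ₗ linearizedEval F ι k c))ᵀ
      map_add' := fun c d => by simp [LinearMap.comp_add]
      map_smul' := fun r c => by simp [LinearMap.comp_smul] }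
  have hΨ : ∀ c, (Ψ c).vecMulLinear = (e : K →ₗ[F] _) ∘ₗ linearizedEval F ι k c := fun c =>
    vecMulLinear_transpose_toMatrix' _
  have hker : ∀ c, c ≠ 0 → finrank F (LinearMap.ker (Ψ c).vecMulLinear) < k := fun c hc => by
    rw [hΨ, LinearEquiv.ker_comp]
    exact finrank_ker_linearizedEval_lt hι hc
  have hinj : Function.Injective Ψ := by
    rw [injective_iff_map_eq_zero]
    intro c hc
    by_contra hc0
    have h1 := hker c hc0
    have h2 := rank_add_finrank_ker_vecMulLinear (Ψ c)
    rw [hc, Matrix.rank_zero] at h2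
    rw [hc] at h1
    omega
  refine ⟨LinearMap.range Ψ, ⟨a, ?_⟩, ?_, ?_⟩
  · apply LinearMap.toMatrixRight'.symm.injective
    exact (hΨ a).trans he
  · rw [LinearMap.finrank_range_of_inj hinj]
    simp [Module.finrank_pi_fintype, hK]
  · rintro _ ⟨c, rfl⟩ hc
    exact hker c fun h => hc (by rw [h, map_zero])

theorem eq_zero_of_mem_dualCode_of_rank_le {k : ℕ} (hk : k ≤ n)
    {D : Submodule F (Matrix (Fin n) (Fin m) F)} (hD : finrank F D = k * m)
    (hker : ∀ N ∈ D, N ≠ 0 → finrank F (LinearMap.ker N.vecMulLinear) < k)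
    {N : Matrix (Fin n) (Fin m) F} (hN : N ∈ dualCode D) (hr : N.rank ≤ k) : N = 0 := by
  obtain ⟨R, hNR, hR⟩ := Submodule.exists_ge_finrank_eq (LinearMap.range N.mulVecLin) hr
    (by simpa using hk)
  let ρ : D →ₗ[F] R →ₗ[F] (Fin m → F) :=
    { toFun := fun M => M.val.vecMulLinear ∘ₗ R.subtype
      map_add' := fun A B => by ext; simp
      map_smul' := fun c A => by ext; simp }
  have hρ : Function.Injective ρ := by
    rw [injective_iff_map_eq_zero]
    intro M hM
    by_contra h0
    have hlt := hker M M.2 (by simpa using h0)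
    have hle : R ≤ LinearMap.ker M.val.vecMulLinear := fun x hx =>
      LinearMap.congr_fun hM ⟨x, hx⟩
    have := Submodule.finrank_mono hle
    omega
  have hsurj : Function.Surjective ρ :=
    (LinearMap.injective_iff_surjective_of_finrank_eq_finrank
      (by simp [hD, hR, Module.finrank_linearMap])).mp hρ
  apply Matrix.transpose_injective
  rw [Matrix.transpose_zero, Matrix.ext_iff_trace_mul_left]
  intro G
  obtain ⟨M, hM⟩ := hsurj (G.vecMulLinear ∘ₗ R.subtype)
  have hMG : Nᵀ * G = Nᵀ * M.val := by
    apply LinearMap.toMatrixRight'.symm.injective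
    refine LinearMap.ext fun y => ?_
    have := LinearMap.congr_fun hM ⟨N.mulVecLin y, hNR ⟨y, rfl⟩⟩
    change y ᵥ* (Nᵀ * G) = y ᵥ* (Nᵀ * M.val)
    rw [← Matrix.vecMul_vecMul, ← Matrix.vecMul_vecMul, Matrix.vecMul_transpose]
    exact this.symm
  rw [Matrix.trace_mul_comm, hMG, Matrix.trace_mul_comm, Matrix.mul_zero, Matrix.trace_zero,
    ← matrixTraceForm_apply, matrixTraceForm_isSymm.eq, matrixTraceForm_apply]
  exact hN M M.2

theorem disjoint_dualCode_of_rank_le {k : ℕ} (hk : k ≤ n)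
    {C D : Submodule F (Matrix (Fin n) (Fin m) F)} (hD : finrank F D = k * m)
    (hker : ∀ N ∈ D, N ≠ 0 → finrank F (LinearMap.ker N.vecMulLinear) < k)
    (hC : ∀ N ∈ C, N.rank ≤ k) : Disjoint C (dualCode D) :=
  Submodule.disjoint_def.mpr fun N hNC hND =>
    eq_zero_of_mem_dualCode_of_rank_le hk hD hker hND (hC N hNC)

theorem finrank_le_mul_of_rank_le [Fintype F] (hnm : n ≤ m) {k : ℕ} (hk : k ≤ n)
    {C : Submodule F (Matrix (Fin n) (Fin m) F)} (hC : ∀ N ∈ C, N.rank ≤ k) :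
    finrank F C ≤ m * k := by
  obtain ⟨D, hD, hker⟩ : ∃ D : Submodule F (Matrix (Fin n) (Fin m) F), finrank F D = k * m ∧
      ∀ N ∈ D, N ≠ 0 → finrank F (LinearMap.ker N.vecMulLinear) < k := by
    rcases Nat.eq_zero_or_pos k with rfl | hk0
    · exact ⟨⊥, by simp, fun N hN h => absurd ((Submodule.mem_bot F).mp hN) h⟩
    · obtain ⟨f, hf⟩ : ∃ f : (Fin n → F) →ₗ[F] (Fin m → F), Function.Injective f :=
        finrank_le_iff_exists_linearMap.mp (by simpa using hnm)
      obtain ⟨D, -, h⟩ := exists_mrd_code_of_finrank_ker_lt (by omega) hnm hk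
        (LinearMap.toMatrix' f)ᵀ
        (by rwa [vecMulLinear_transpose_toMatrix', LinearMap.ker_eq_bot.mpr hf, finrank_bot])
      exact ⟨D, h⟩
  have h1 := Submodule.finrank_add_finrank_le_of_disjoint
    (disjoint_dualCode_of_rank_le hk hD hker hC)
  have h2 := finrank_add_finrank_dualCode D
  simp only [Module.finrank_matrix, Fintype.card_fin, finrank_self, mul_one] at h1
  rw [mul_comm m k]
  omega

theorem maxrk_le_height (C : Submodule F (Matrix (Fin n) (Fin m) F)) : maxrk C ≤ n :=
  maxrk_le fun M _ => M.rank_le_height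

theorem finrank_le_mul_maxrk [Fintype F] (hnm : n ≤ m)
    (C : Submodule F (Matrix (Fin n) (Fin m) F)) : finrank F C ≤ m * maxrk C :=
  finrank_le_mul_of_rank_le hnm (maxrk_le_height C) fun _ => rank_le_maxrk

theorem maxrk_dualCode_le_of_isOptAnticode [Fintype F] (hm : 0 < m) (hnm : n ≤ m)
    {C : Submodule F (Matrix (Fin n) (Fin m) F)} (hC : isOptAnticode C) :
    maxrk (dualCode C) ≤ n - maxrk C := by
  refine maxrk_le fun M hM => ?_
  by_contra! hlt
  have hk := maxrk_le_height C
  have hMn := rank_add_finrank_ker_vecMulLinear M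
  obtain ⟨D, hMD, hD, hker⟩ := exists_mrd_code_of_finrank_ker_lt hm hnm hk M (by omega)
  have hdisj := disjoint_dualCode_of_rank_le hk hD hker fun _ => rank_le_maxrk
  have htop : C ⊔ dualCode D = ⊤ := by
    apply Submodule.eq_top_of_disjoint _ _ _ hdisj
    rw [Module.finrank_matrix, Fintype.card_fin, Fintype.card_fin, finrank_self, mul_one,
      ← finrank_add_finrank_dualCode D, hD, hC, mul_comm]
  have hM0 : M = 0 := by
    apply matrixTraceForm_nondegenerate.1
    intro N
    have hN : N ∈ C ⊔ dualCode D := htop ▸ Submodule.mem_top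
    obtain ⟨A, hA, B, hB, rfl⟩ := Submodule.mem_sup.mp hN
    rw [map_add, matrixTraceForm_apply, hM A hA, zero_add, matrixTraceForm_isSymm.eq M B,
      matrixTraceForm_apply, hB M hMD]
  rw [hM0, Matrix.rank_zero] at hlt
  omega

end RankMetric

/-- `C` is an optimal anticode iff `maxrk(C) + maxrk(C^⊥) = n`. -/
theorem stmt1 {𝔽 : Type*} [Field 𝔽] [Fintype 𝔽] {n m : ℕ} (hn : 1 ≤ n) (hnm : n ≤ m)
    (C : Submodule 𝔽 (Matrix (Fin n) (Fin m) 𝔽)) :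
    isOptAnticode C ↔ maxrk C + maxrk (dualCode C) = n := by
  have h1 := finrank_add_finrank_dualCode C
  have h2 := finrank_le_mul_maxrk hnm C
  have h3 := finrank_le_mul_maxrk hnm (dualCode C)
  have hm : 0 < m := by omega
  constructor
  · intro hC
    have h4 := maxrk_dualCode_le_of_isOptAnticode hm hnm hC
    have h5 := maxrk_le_height C
    have h6 : m * n ≤ m * (maxrk C + maxrk (dualCode C)) := by
      rw [mul_add, mul_comm m n]
      omega
    have h7 := Nat.le_of_mul_le_mul_left h6 hm
    omega
  · intro h
    have h4 : m * maxrk C + m * maxrk (dualCode C) = n * m := by rw [← mul_add, h, mul_comm]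
    exact le_antisymm h2 (by omega)
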